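/- Strong duality for the semi-infinite problem with continuous data on a compact set under a Slater condition: suppose Φ is compact, h, φ_s, ψ_t are continuous on Φ, the dual value Val(D) = inf{Σ_s a_s y_s + Σ_t b_t z_t : y ∈ ℝ^M_+, z ∈ ℝ^N, Σ_s y_s φ_s(x) + Σ_t z_t ψ_t(x) ≥ h(x) ∀x ∈ Φ} is finite, and there exists (ȳ, z̄) ∈ ℝ^M_+ × ℝ^N with Σ_s ȳ_s φ_s(x) + Σ_t z̄_t ψ_t(x) − h(x) > 0 for all x ∈ Φ. Then Val(P) = Val(D), where Val(P) = sup{∫_Φ h dF : F ≥ 0 a Borel measure, ∫_Φ φ_s dF ≤ a_s ∀s, ∫_Φ ψ_t dF = b_t ∀t}, and the set of optimal solutions F of the primal problem is bounded in total variation. -/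

import Mathlib

open MeasureTheory

/-- In finite dimension, the convex hull of a compact set is compact. -/
theorem IsCompact.convexHull_of_finiteDimensional {E : Type*} [NormedAddCommGroup E]
    [NormedSpace ℝ E] [FiniteDimensional ℝ E] {T : Set E} (hT : IsCompact T) :
    IsCompact (convexHull ℝ T) := by
  rcases T.eq_empty_or_nonempty with rfl | ⟨x₀, hx₀⟩
  · simp
  let d := Module.finrank ℝ E + 1
  suffices convexHull ℝ T = (fun q : (Fin d → ℝ) × (Fin d → E) => ∑ i, q.1 i • q.2 i) ''
      (stdSimplex ℝ (Fin d) ×ˢ Set.univ.pi fun _ => T) by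
    rw [this]
    exact ((isCompact_stdSimplex ℝ (Fin d)).prod (isCompact_univ_pi fun _ => hT)).image
      (by fun_prop)
  apply Set.Subset.antisymm
  · intro x hx
    obtain ⟨ι, _, z, w, hzT, hz, hw, hw1, rfl⟩ := eq_pos_convex_span_of_mem_convexHull hx
    have hcard : Fintype.card ι ≤ Fintype.card (Fin d) := by
      simpa [d] using hz.card_le_finrank_succ.trans
        (Nat.succ_le_succ (Submodule.finrank_le (vectorSpan ℝ (Set.range z))))
    obtain ⟨e⟩ := Function.Embedding.nonempty_of_card_le hcard
    have hext : ∀ j ∉ Set.range e, Function.extend e w (fun _ => 0) j = 0 := fun j hj =>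
      Function.extend_apply' w (fun _ => 0) j hj
    refine ⟨(Function.extend e w (fun _ => 0), Function.extend e z fun _ => x₀), ⟨⟨fun j => ?_, ?_⟩, ?_⟩, ?_⟩
    · by_cases hj : j ∈ Set.range e
      · obtain ⟨i, rfl⟩ := hj
        simpa [e.injective.extend_apply] using (hw i).le
      · exact (hext j hj).ge
    · rw [← hw1]
      exact (Fintype.sum_of_injective e e.injective _ _ hext
        fun i => (e.injective.extend_apply w (fun _ => 0) i).symm).symm
    · intro j _
      by_cases hj : j ∈ Set.range e
      · obtain ⟨i, rfl⟩ := hj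
        simpa [e.injective.extend_apply] using hzT ⟨i, rfl⟩
      · simpa [Function.extend_apply' z _ j hj] using hx₀
    · refine (Fintype.sum_of_injective e e.injective _ _ (fun j hj => ?_) fun i => ?_).symm
      · simp [hext j hj]
      · simp [e.injective.extend_apply]
  · rintro _ ⟨⟨w, z⟩, ⟨hw, hz⟩, rfl⟩
    exact (convex_convexHull ℝ T).sum_mem (fun i _ => hw.1 i) hw.2
      fun i _ => subset_convexHull ℝ T (hz i trivial)

/-- A cone containing a compact set `T`, on which some linear functional is positive, contains
every point on which all functionals nonnegative on `T` are nonnegative. -/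
theorem PointedCone.mem_of_forall_nonneg_of_isCompact {E : Type*} [NormedAddCommGroup E]
    [NormedSpace ℝ E] [FiniteDimensional ℝ E] {T : Set E} (hT : IsCompact T) (L : E →L[ℝ] ℝ)
    (hL : ∀ x ∈ T, 0 < L x) (C : PointedCone ℝ E) (hTC : T ⊆ C) {p : E}
    (hp : ∀ f : E →L[ℝ] ℝ, (∀ x ∈ T, 0 ≤ f x) → 0 ≤ f p) : p ∈ C := by
  have hLp : 0 ≤ L p := hp L fun x hx => (hL x hx).le
  rcases hLp.eq_or_lt with h0 | hpos
  · suffices p = 0 by rw [this]; exact C.zero_mem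
    by_contra hne
    obtain ⟨g, -, hg⟩ := exists_dual_vector ℝ p (norm_ne_zero_iff.2 hne)
    obtain ⟨ε, hε, hεL⟩ := hT.exists_forall_le' L.continuous.continuousOn hL
    obtain ⟨B, hB⟩ := hT.exists_bound_of_continuousOn g.continuous.continuousOn
    have hmem : ∀ x ∈ T, 0 ≤ ((|B| / ε) • L - g) x := by
      intro x hx
      have h1 : g x ≤ |B| := (le_abs_self _).trans ((hB x hx).trans (le_abs_self _))
      have h2 : |B| / ε * ε ≤ |B| / ε * L x :=
        mul_le_mul_of_nonneg_left (hεL x hx) (by positivity)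
      rw [div_mul_cancel₀ _ hε.ne'] at h2
      simpa using h1.trans h2
    have hfp := hp _ hmem
    simp [← h0, hg] at hfp
    exact hne hfp
  · set T' : Set E := (fun x => (L x)⁻¹ • x) '' T
    have hT' : IsCompact T' := hT.image_of_continuousOn <|
      (L.continuous.continuousOn.inv₀ fun x hx => (hL x hx).ne').smul continuousOn_id
    have hT'C : convexHull ℝ T' ⊆ C := by
      refine convexHull_min ?_ C.convex
      rintro _ ⟨x, hx, rfl⟩
      exact C.smul_mem (inv_pos.2 (hL x hx)).le (hTC hx)
    have hq : (L p)⁻¹ • p ∈ convexHull ℝ T' := by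
      by_contra hq
      obtain ⟨f, u, hfp, hfT⟩ := geometric_hahn_banach_point_closed (convex_convexHull ℝ T')
        hT'.convexHull_of_finiteDimensional.isClosed hq
      have hmem : ∀ x ∈ T, 0 ≤ (f - u • L) x := by
        intro x hx
        have h1 := hfT _ (subset_convexHull ℝ T' ⟨x, hx, rfl⟩)
        rw [map_smul, smul_eq_mul, inv_mul_eq_div, lt_div_iff₀ (hL x hx)] at h1
        simpa using h1.le
      have h2 := hp _ hmem
      rw [map_smul, smul_eq_mul, inv_mul_eq_div, div_lt_iff₀ hpos] at hfp
      simp at h2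
      linarith
    have h3 := C.smul_mem hpos.le (hT'C hq)
    rwa [smul_inv_smul₀ hpos.ne' p] at h3

section MomentCone

variable {X ι κ : Type*} [TopologicalSpace X] [Fintype ι] [Fintype κ]

/-- The pairing of `(y, z, c)` with `(u, w, r)`, as a linear functional of `(u, w, r)`. -/
noncomputable def momentFunctional (y : ι → ℝ) (z : κ → ℝ) (c : ℝ) :
    ((ι → ℝ) × (κ → ℝ) × ℝ) →L[ℝ] ℝ :=
  LinearMap.toContinuousLinearMap
    { toFun := fun p => (∑ s, y s * p.1 s) + (∑ t, z t * p.2.1 t) - c * p.2.2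
      map_add' := by
        intro p q
        simp only [Prod.fst_add, Prod.snd_add, Pi.add_apply, mul_add, Finset.sum_add_distrib]
        ring
      map_smul' := by
        intro r p
        simp only [Prod.smul_fst, Prod.smul_snd, Pi.smul_apply, smul_eq_mul, RingHom.id_apply,
          mul_sub, mul_add, Finset.mul_sum, mul_left_comm] }

@[simp]
theorem momentFunctional_apply (y : ι → ℝ) (z : κ → ℝ) (c : ℝ) (p : (ι → ℝ) × (κ → ℝ) × ℝ) :
    momentFunctional y z c p = (∑ s, y s * p.1 s) + (∑ t, z t * p.2.1 t) - c * p.2.2 :=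
  rfl

theorem exists_eq_momentFunctional (f : ((ι → ℝ) × (κ → ℝ) × ℝ) →L[ℝ] ℝ) :
    ∃ y z c, f = momentFunctional y z c := by
  classical
  refine ⟨fun s => f (Pi.single s 1, 0, 0), fun t => f (0, Pi.single t 1, 0), -f (0, 0, 1), ?_⟩
  apply ContinuousLinearMap.coe_injective
  ext
  · simp [Pi.single_apply]
    rfl
  · simp [Pi.single_apply]
  · simp

variable {h : X → ℝ} {φ : ι → X → ℝ} {ψ : κ → X → ℝ}

theorem Continuous.dual_combination (hφ : ∀ s, Continuous (φ s)) (hψ : ∀ t, Continuous (ψ t))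
    (y : ι → ℝ) (z : κ → ℝ) :
    Continuous fun x => (∑ s, y s * φ s x) + ∑ t, z t * ψ t x := by
  fun_prop

variable [CompactSpace X]

/-- A Slater point can be moved to one with positive multipliers. -/
theorem exists_slater_pos (hh : Continuous h) (hφ : ∀ s, Continuous (φ s))
    (hψ : ∀ t, Continuous (ψ t)) {y : ι → ℝ} {z : κ → ℝ} (hy : ∀ s, 0 ≤ y s)
    (hyz : ∀ x, h x < (∑ s, y s * φ s x) + ∑ t, z t * ψ t x) :
    ∃ y' : ι → ℝ, (∀ s, 0 < y' s) ∧ ∀ x, h x < (∑ s, y' s * φ s x) + ∑ t, z t * ψ t x := by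
  obtain ⟨ε, hε, hεg⟩ := isCompact_univ.exists_forall_le'
    ((Continuous.dual_combination hφ hψ y z).sub hh).continuousOn
    (fun x _ => sub_pos.2 (hyz x))
  obtain ⟨B, hB⟩ := isCompact_univ.exists_bound_of_continuousOn
    (continuous_finsetSum Finset.univ fun s _ => hφ s).continuousOn
  have hδ : 0 < ε / (|B| + 1) := by positivity
  refine ⟨fun s => y s + ε / (|B| + 1), fun s => add_pos_of_nonneg_of_pos (hy s) hδ, fun x => ?_⟩
  have h1 : ε ≤ (∑ s, y s * φ s x) + (∑ t, z t * ψ t x) - h x := hεg x trivial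
  have h2 : -(|B| + 1) < ∑ s, φ s x := by
    have := (abs_le.1 ((hB x trivial).trans (le_abs_self B))).1
    linarith
  have h3 := mul_lt_mul_of_pos_left h2 hδ
  have h4 : ε / (|B| + 1) * -(|B| + 1) = -ε := by field_simp
  simp only [add_mul, Finset.sum_add_distrib, ← Finset.mul_sum]
  linarith

variable [MeasurableSpace X] [BorelSpace X]

theorem Continuous.integrable_of_compactSpace {f : X → ℝ} (hf : Continuous f) (F : Measure X)
    [IsFiniteMeasure F] : Integrable f F :=
  hf.integrable_of_hasCompactSupport (HasCompactSupport.of_compactSpace f)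

/-- The cone of triples `(u, w, r)` such that some finite measure has `φ`-moments at most `u`,
`ψ`-moments equal to `w` and `h`-moment at least `r`. -/
def momentCone (hh : Continuous h)
    (hφ : ∀ s, Continuous (φ s)) (hψ : ∀ t, Continuous (ψ t)) :
    PointedCone ℝ ((ι → ℝ) × (κ → ℝ) × ℝ) where
  carrier := {p | ∃ F : Measure X, IsFiniteMeasure F ∧ (∀ s, ∫ x, φ s x ∂F ≤ p.1 s) ∧
    (∀ t, ∫ x, ψ t x ∂F = p.2.1 t) ∧ p.2.2 ≤ ∫ x, h x ∂F}
  zero_mem' := ⟨0, inferInstance, by simp⟩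
  add_mem' := by
    rintro p q ⟨F, hF, h1, h2, h3⟩ ⟨G, hG, g1, g2, g3⟩
    refine ⟨F + G, inferInstance, fun s => ?_, fun t => ?_, ?_⟩
    · rw [integral_add_measure ((hφ s).integrable_of_compactSpace F)
        ((hφ s).integrable_of_compactSpace G)]
      exact add_le_add (h1 s) (g1 s)
    · rw [integral_add_measure ((hψ t).integrable_of_compactSpace F)
        ((hψ t).integrable_of_compactSpace G), h2, g2]
      rfl
    · rw [integral_add_measure (hh.integrable_of_compactSpace F)
        (hh.integrable_of_compactSpace G)]
      exact add_le_add h3 g3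
  smul_mem' := by
    rintro (c : NNReal) p ⟨F, hF, h1, h2, h3⟩
    refine ⟨c • F, inferInstance, fun s => ?_, fun t => ?_, ?_⟩
    · rw [integral_smul_nnreal_measure]
      exact mul_le_mul_of_nonneg_left (h1 s) c.2
    · rw [integral_smul_nnreal_measure, h2]
      rfl
    · rw [integral_smul_nnreal_measure]
      exact mul_le_mul_of_nonneg_left h3 c.2

theorem exists_measure_of_forall_dual_le [T2Space X] (hh : Continuous h) (hφ : ∀ s, Continuous (φ s))
    (hψ : ∀ t, Continuous (ψ t)) (a : ι → ℝ) (b : κ → ℝ) (v : ℝ)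
    (hv : ∀ (y : ι → ℝ) (z : κ → ℝ), (∀ s, 0 ≤ y s) →
      (∀ x, h x ≤ (∑ s, y s * φ s x) + ∑ t, z t * ψ t x) →
      v ≤ (∑ s, a s * y s) + ∑ t, b t * z t)
    (hS : ∃ (y : ι → ℝ) (z : κ → ℝ), (∀ s, 0 ≤ y s) ∧
      ∀ x, h x < (∑ s, y s * φ s x) + ∑ t, z t * ψ t x) :
    ∃ F : Measure X, IsFiniteMeasure F ∧ (∀ s, ∫ x, φ s x ∂F ≤ a s) ∧
      (∀ t, ∫ x, ψ t x ∂F = b t) ∧ v ≤ ∫ x, h x ∂F := by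
  classical
  obtain ⟨y₁, z₀, hy₁, hyz₁⟩ := hS
  obtain ⟨y₀, hy₀, hyz₀⟩ := exists_slater_pos hh hφ hψ hy₁ hyz₁
  let m : X → (ι → ℝ) × (κ → ℝ) × ℝ := fun x => (fun s => φ s x, fun t => ψ t x, h x)
  let e : ι → (ι → ℝ) × (κ → ℝ) × ℝ := fun s => (Pi.single s 1, 0, 0)
  let d : (ι → ℝ) × (κ → ℝ) × ℝ := (0, 0, -1)
  have hm : Continuous m := by fun_prop
  have hT : IsCompact (Set.range m ∪ (Set.range e ∪ {d})) :=
    (isCompact_range hm).union ((Set.finite_range e).isCompact.union isCompact_singleton)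
  suffices ((a, b, v) : (ι → ℝ) × (κ → ℝ) × ℝ) ∈ momentCone hh hφ hψ from this
  refine PointedCone.mem_of_forall_nonneg_of_isCompact hT (momentFunctional y₀ z₀ 1) ?_ _ ?_ ?_
  · rintro _ (⟨x, rfl⟩ | ⟨s, rfl⟩ | rfl)
    · simpa [m] using hyz₀ x
    · simpa [e, Pi.single_apply] using hy₀ s
    · simp [d]
  · rintro _ (⟨x, rfl⟩ | ⟨s, rfl⟩ | rfl)
    · exact ⟨Measure.dirac x, inferInstance, by simp [m], by simp [m], by simp [m]⟩
    · refine ⟨0, inferInstance, fun i => ?_, by simp [e], by simp [e]⟩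
      by_cases hi : i = s <;> simp [e, hi]
    · exact ⟨0, inferInstance, by simp [d], by simp [d], by simp [d]⟩
  · intro f hf
    obtain ⟨y, z, c, rfl⟩ := exists_eq_momentFunctional f
    have hfm : ∀ x, c * h x ≤ (∑ s, y s * φ s x) + ∑ t, z t * ψ t x := fun x => by
      simpa [m] using hf (m x) (Or.inl ⟨x, rfl⟩)
    have hy : ∀ s, 0 ≤ y s := fun s => by
      simpa [e, Pi.single_apply] using hf (e s) (Or.inr (Or.inl ⟨s, rfl⟩))
    have hc : 0 ≤ c := by simpa [d] using hf d (Or.inr (Or.inr rfl))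
    have hD₀ := hv y₀ z₀ (fun s => (hy₀ s).le) fun x => (hyz₀ x).le
    set D₀ := (∑ s, a s * y₀ s) + ∑ t, b t * z₀ t with hD₀_def
    have key : ∀ ε : ℝ, 0 < ε →
        v * (c + ε) ≤ (∑ s, a s * y s) + (∑ t, b t * z t) + ε * D₀ := by
      intro ε hε
      have hcε : 0 < c + ε := by linarith
      have h1 := hv (fun s => (c + ε)⁻¹ * (y s + ε * y₀ s)) (fun t => (c + ε)⁻¹ * (z t + ε * z₀ t))
        (fun s => mul_nonneg (inv_pos.2 hcε).le
          (add_nonneg (hy s) (mul_nonneg hε.le (hy₀ s).le))) ?_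
      · simp only [mul_left_comm _ (c + ε)⁻¹, ← Finset.mul_sum, ← mul_add] at h1
        rw [inv_mul_eq_div, le_div_iff₀ hcε] at h1
        simp only [mul_add, mul_left_comm _ ε, Finset.sum_add_distrib, ← Finset.mul_sum] at h1
        rw [hD₀_def]
        linarith
      · intro x
        simp only [mul_assoc, ← Finset.mul_sum, ← mul_add]
        rw [inv_mul_eq_div, le_div_iff₀ hcε]
        simp only [add_mul, mul_assoc, Finset.sum_add_distrib, ← Finset.mul_sum]
        have h2 := mul_le_mul_of_nonneg_left (hyz₀ x).le hε.le
        have h3 := hfm x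
        linarith
    have hgoal : v * c ≤ (∑ s, a s * y s) + ∑ t, b t * z t := by
      refine le_of_forall_pos_le_add fun δ hδ => ?_
      have h1 := key (δ / (D₀ - v + 1)) (div_pos hδ (by linarith))
      have h2 : δ / (D₀ - v + 1) * (D₀ - v + 1) = δ := div_mul_cancel₀ _ (by linarith)
      have h3 : 0 < δ / (D₀ - v + 1) := div_pos hδ (by linarith)
      linarith
    have hcomm : c * v = v * c := mul_comm c v
    simp only [momentFunctional_apply, mul_comm (y _), mul_comm (z _), hcomm]
    linarith

theorem integral_dual_combination_le (hφ : ∀ s, Continuous (φ s)) (hψ : ∀ t, Continuous (ψ t))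
    {a : ι → ℝ} {b : κ → ℝ} {y : ι → ℝ} (z : κ → ℝ) (hy : ∀ s, 0 ≤ y s) (F : Measure X)
    [IsFiniteMeasure F] (hFa : ∀ s, ∫ x, φ s x ∂F ≤ a s) (hFb : ∀ t, ∫ x, ψ t x ∂F = b t) :
    ∫ x, (∑ s, y s * φ s x) + ∑ t, z t * ψ t x ∂F ≤ (∑ s, a s * y s) + ∑ t, b t * z t := by
  have hi₁ : ∀ s ∈ Finset.univ, Integrable (fun x => y s * φ s x) F := fun s _ =>
    ((hφ s).integrable_of_compactSpace F).const_mul _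
  have hi₂ : ∀ t ∈ Finset.univ, Integrable (fun x => z t * ψ t x) F := fun t _ =>
    ((hψ t).integrable_of_compactSpace F).const_mul _
  rw [integral_add (integrable_finsetSum _ hi₁) (integrable_finsetSum _ hi₂),
    integral_finsetSum _ hi₁, integral_finsetSum _ hi₂]
  simp only [integral_const_mul, hFb, mul_comm (a _), mul_comm (b _)]
  gcongr with s
  · exact hy s
  · exact hFa s

end MomentCone

/-- Strong duality for the semi-infinite problem with continuous data on a compact set
`Φ ⊆ ℝ^n`, under a Slater condition: if the dual value is finite and some
`(ȳ, z̄) ∈ ℝ^M₊ × ℝ^N` satisfies the dual constraint strictly on all of `Φ`, then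
`Val(P) = Val(D)` and the set of optimal primal measures is bounded in total
variation. -/
theorem strong_duality_semi_infinite
    {n M N : ℕ} (Φ : Set (Fin n → ℝ)) (hΦc : IsCompact Φ)
    (h : (Fin n → ℝ) → ℝ) (φ : Fin M → (Fin n → ℝ) → ℝ) (ψ : Fin N → (Fin n → ℝ) → ℝ)
    (hh : ContinuousOn h Φ)
    (hφ : ∀ s, ContinuousOn (φ s) Φ)
    (hψ : ∀ t, ContinuousOn (ψ t) Φ)
    (a : Fin M → ℝ) (b : Fin N → ℝ)
    (ValP ValD : EReal)
    (hValP : ValP = sSup {r : EReal | ∃ F : Measure ↥Φ, IsFiniteMeasure F ∧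
        (∀ s, ∫ x : ↥Φ, φ s x ∂F ≤ a s) ∧ (∀ t, ∫ x : ↥Φ, ψ t x ∂F = b t) ∧
        r = ((∫ x : ↥Φ, h x ∂F : ℝ) : EReal)})
    (hValD : ValD = sInf {r : EReal | ∃ y : Fin M → ℝ, ∃ z : Fin N → ℝ,
        (∀ s, 0 ≤ y s) ∧
        (∀ x ∈ Φ, h x ≤ (∑ s, y s * φ s x) + ∑ t, z t * ψ t x) ∧
        r = (((∑ s, a s * y s) + ∑ t, b t * z t : ℝ) : EReal)})
    (hDfin : ValD ≠ ⊥ ∧ ValD ≠ ⊤)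
    -- Slater condition
    (hSlater : ∃ ybar : Fin M → ℝ, ∃ zbar : Fin N → ℝ, (∀ s, 0 ≤ ybar s) ∧
      ∀ x ∈ Φ, h x < (∑ s, ybar s * φ s x) + ∑ t, zbar t * ψ t x) :
    ValP = ValD ∧
    ∃ Cb : ℝ, ∀ F : Measure ↥Φ, IsFiniteMeasure F →
      (∀ s, ∫ x : ↥Φ, φ s x ∂F ≤ a s) → (∀ t, ∫ x : ↥Φ, ψ t x ∂F = b t) →
      ((∫ x : ↥Φ, h x ∂F : ℝ) : EReal) = ValP →
      (F Set.univ).toReal ≤ Cb := by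
  have : CompactSpace Φ := isCompact_iff_compactSpace.1 hΦc
  have hh' : Continuous fun x : Φ => h x := hh.domRestrict
  have hφ' : ∀ s, Continuous fun x : Φ => φ s x := fun s => (hφ s).domRestrict
  have hψ' : ∀ t, Continuous fun x : Φ => ψ t x := fun t => (hψ t).domRestrict
  obtain ⟨v, rfl⟩ : ∃ v : ℝ, (v : EReal) = ValD := ⟨ValD.toReal, EReal.coe_toReal hDfin.2 hDfin.1⟩
  have hv : ∀ (y : Fin M → ℝ) (z : Fin N → ℝ), (∀ s, 0 ≤ y s) →
      (∀ x : Φ, h x ≤ (∑ s, y s * φ s x) + ∑ t, z t * ψ t x) →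
      v ≤ (∑ s, a s * y s) + ∑ t, b t * z t := by
    intro y z hy hyz
    rw [← EReal.coe_le_coe_iff, hValD]
    exact sInf_le ⟨y, z, hy, fun x hx => hyz ⟨x, hx⟩, rfl⟩
  obtain ⟨y₀, z₀, hy₀, hyz₀⟩ := hSlater
  have hPD : ValP = v := by
    apply le_antisymm
    · rw [hValP, hValD]
      refine sSup_le ?_
      rintro _ ⟨F, hF, hFa, hFb, rfl⟩
      refine le_sInf ?_
      rintro _ ⟨y, z, hy, hyz, rfl⟩
      refine EReal.coe_le_coe_iff.2 (le_trans ?_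
        (integral_dual_combination_le hφ' hψ' z hy F hFa hFb))
      exact integral_mono (hh'.integrable_of_compactSpace F)
        ((Continuous.dual_combination hφ' hψ' y z).integrable_of_compactSpace F)
        fun x => hyz x x.2
    · obtain ⟨F, hF, hFa, hFb, hFv⟩ := exists_measure_of_forall_dual_le hh' hφ' hψ' a b v hv
        ⟨y₀, z₀, hy₀, fun x => hyz₀ x x.2⟩
      rw [hValP]
      exact (EReal.coe_le_coe_iff.2 hFv).trans (le_sSup ⟨F, hF, hFa, hFb, rfl⟩)
  refine ⟨hPD, ?_⟩
  obtain ⟨ε, hε, hεg⟩ := isCompact_univ.exists_forall_le'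
    ((Continuous.dual_combination hφ' hψ' y₀ z₀).sub hh').continuousOn
    (fun x _ => sub_pos.2 (hyz₀ x x.2))
  refine ⟨((∑ s, a s * y₀ s) + (∑ t, b t * z₀ t) - v) / ε, fun F hF hFa hFb hFv => ?_⟩
  have hFv' : ∫ x : Φ, h x ∂F = v := EReal.coe_injective (hFv.trans hPD)
  have hi := (Continuous.dual_combination hφ' hψ' y₀ z₀).integrable_of_compactSpace F
  have h1 : ∫ _ : Φ, ε ∂F ≤ ∫ x : Φ, ((∑ s, y₀ s * φ s x) + ∑ t, z₀ t * ψ t x) - h x ∂F :=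
    integral_mono (integrable_const ε) (hi.sub (hh'.integrable_of_compactSpace F))
      fun x => hεg x trivial
  rw [integral_sub hi (hh'.integrable_of_compactSpace F), hFv', integral_const, smul_eq_mul] at h1
  have h2 := integral_dual_combination_le hφ' hψ' z₀ hy₀ F hFa hFb
  rw [le_div_iff₀ hε]
  exact h1.trans (by linarith)
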